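/- arXiv:2405.03112 — 2 statements merged into one kernel-verified Lean document; each statement's English description precedes it below -/
import Mathlib

section
/- There exist constants C > 0 and k_0 such that the following holds for all k ≥ k_0. Let η be a real number with C·log k/(k−1) < η ≤ 1, let R be a connected rainbow graph on vertex set [k] with edge set E and minimum degree at least η(k−1), viewed as a T-edge-colored complete graph with T = E ∪ {∅}, and let H be an n-vertex T-edge-colored complete graph in which every vertex x satisfies d(x) ≥ n^{k−1}/(k^{k−1}−1). Then for every x ∈ V(H) and every edge e ∈ E, the color degree d_e(x) is less than η·n/4. -/
open Finset Filter

open scoped Classical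

section Defs

variable {T : Type}

/-- A coloring of the complete graph is symmetric. -/
def IsSym {V : Type} (χ : V → V → T) : Prop := ∀ u v, χ u v = χ v u

/-- `copyCount k n R χ` : the number of `k`-element subsets of `Fin n` whose coloring
induced by `χ` is isomorphic (as an edge-colored complete graph) to `R`. -/
noncomputable def copyCount (k n : ℕ) (R : Fin k → Fin k → T) (χ : Fin n → Fin n → T) : ℕ :=
  ((Finset.powersetCard k (Finset.univ : Finset (Fin n))).filter
    (fun S => ∃ φ : Fin k → Fin n, Function.Injective φ ∧ (∀ a, φ a ∈ S) ∧
      ∀ a b : Fin k, a ≠ b → χ (φ a) (φ b) = R a b)).card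

/-- `maxCopyCount k n R = I(R,n)` : the maximum of `copyCount` over all symmetric
`T`-colorings of the complete graph on `n` vertices. -/
noncomputable def maxCopyCount [Fintype T] (k n : ℕ) (R : Fin k → Fin k → T) : ℕ :=
  Finset.sup ((Finset.univ : Finset (Fin n → Fin n → T)).filter (fun χ => IsSym χ))
    (fun χ => copyCount k n R χ)

/-- `vertDeg k n R χ x = d(x)` : the number of `k`-subsets containing `x` whose induced
coloring is isomorphic to `R`. -/
noncomputable def vertDeg (k n : ℕ) (R : Fin k → Fin k → T) (χ : Fin n → Fin n → T)
    (x : Fin n) : ℕ :=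
  ((Finset.powersetCard k (Finset.univ : Finset (Fin n))).filter
    (fun S => x ∈ S ∧ ∃ φ : Fin k → Fin n, Function.Injective φ ∧ (∀ a, φ a ∈ S) ∧
      ∀ a b : Fin k, a ≠ b → χ (φ a) (φ b) = R a b)).card

/-- `embCount k n R χ i x = d_i(x)` : the number of injective color-preserving maps
`φ : Fin k → Fin n` with `φ i = x`. -/
noncomputable def embCount (k n : ℕ) (R : Fin k → Fin k → T) (χ : Fin n → Fin n → T)
    (i : Fin k) (x : Fin n) : ℕ :=
  ((Finset.univ : Finset (Fin k → Fin n)).filter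
    (fun φ => Function.Injective φ ∧ φ i = x ∧
      ∀ a b : Fin k, a ≠ b → χ (φ a) (φ b) = R a b)).card

/-- `Nset k n R χ i x = N_i(x)` : the set of vertices `y ≠ x` lying in the image of some
injective color-preserving map `φ : Fin k → Fin n` with `φ i = x`. -/
noncomputable def Nset (k n : ℕ) (R : Fin k → Fin k → T) (χ : Fin n → Fin n → T)
    (i : Fin k) (x : Fin n) : Finset (Fin n) :=
  (Finset.univ : Finset (Fin n)).filter
    (fun y => y ≠ x ∧ ∃ φ : Fin k → Fin n, Function.Injective φ ∧ φ i = x ∧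
      (∀ a b : Fin k, a ≠ b → χ (φ a) (φ b) = R a b) ∧ ∃ a, φ a = y)

/-- `colorDeg χ x c = d_c(x)` : the number of vertices `y ≠ x` with `χ x y = c`. -/
noncomputable def colorDeg {n : ℕ} (χ : Fin n → Fin n → T) (x : Fin n) (c : T) : ℕ :=
  ((Finset.univ : Finset (Fin n)).filter (fun y => y ≠ x ∧ χ x y = c)).card

end Defs

/-- The rainbow `k`-clique: the edge `ij` gets color `{i,j}`. -/
def rainbowClique (k : ℕ) : Fin k → Fin k → Finset (Fin k) := fun i j => {i, j}

/-- A rainbow graph `G` on `[k]`, viewed as an edge-colored complete graph: edges `ij ∈ E`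
get color `{i,j}`, non-edges get color `∅`. -/
noncomputable def rainbowOf {k : ℕ} (G : SimpleGraph (Fin k)) :
    Fin k → Fin k → Finset (Fin k) :=
  fun i j => if G.Adj i j then {i, j} else ∅

/-- `B(x)` : the set of neighbors of `x`, i.e. vertices joined to `x` by a non-`∅` color. -/
noncomputable def Bset {k n : ℕ} (χ : Fin n → Fin n → Finset (Fin k)) (x : Fin n) :
    Finset (Fin n) :=
  (Finset.univ : Finset (Fin n)).filter (fun y => y ≠ x ∧ χ x y ≠ ∅)

/-- The degree of vertex `i` in the graph `G`. -/
noncomputable def degR {k : ℕ} (G : SimpleGraph (Fin k)) (i : Fin k) : ℕ :=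
  ((Finset.univ : Finset (Fin k)).filter (fun j => G.Adj i j)).card

/-- The product of nonnegative reals is at most the matching power of their mean. -/
lemma prod_le_sum_div_card_pow {ι : Type*} (s : Finset ι) (z : ι → ℝ)
    (hz : ∀ i ∈ s, 0 ≤ z i) :
    ∏ i ∈ s, z i ≤ ((∑ i ∈ s, z i) / (s.card : ℝ)) ^ s.card := by
  rcases s.eq_empty_or_nonempty with rfl | hs
  · simp
  have hc : (0 : ℝ) < s.card := by exact_mod_cast hs.card_pos
  have h := Real.geom_mean_le_arith_mean s (fun _ => 1) z (by simp) (by simpa using hc) hz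
  simp only [Real.rpow_one, one_mul, sum_const, nsmul_eq_mul, mul_one] at h
  have h0 : 0 ≤ ∏ i ∈ s, z i := prod_nonneg hz
  calc ∏ i ∈ s, z i = ((∏ i ∈ s, z i) ^ ((s.card : ℝ)⁻¹)) ^ s.card :=
        (Real.rpow_inv_natCast_pow h0 hs.card_pos.ne').symm
    _ ≤ _ := pow_le_pow_left₀ (Real.rpow_nonneg h0 _) h _

/-- The mean inequality when the factors outside `N` share a total of `y` equally. -/
lemma prod_mul_div_pow_le {ι : Type*} [DecidableEq ι] {s N : Finset ι} (hN : N ⊆ s) {c : ι → ℝ}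
    (hc : ∀ b ∈ N, 0 ≤ c b) {y : ℝ} (hy : 0 ≤ y) :
    (∏ b ∈ N, c b) * (y / ((s \ N).card : ℝ)) ^ (s \ N).card ≤
      ((y + ∑ b ∈ N, c b) / (s.card : ℝ)) ^ s.card := by
  set z : ι → ℝ := fun b => if b ∈ N then c b else y / ((s \ N).card : ℝ) with hz
  have hzN : ∀ b ∈ N, z b = c b := fun b hb => if_pos hb
  have hzs : ∀ b ∈ s \ N, z b = y / ((s \ N).card : ℝ) := fun b hb => if_neg (mem_sdiff.1 hb).2
  have hz0 : ∀ b ∈ s, 0 ≤ z b := fun b _ => by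
    by_cases hb : b ∈ N
    · rw [hzN b hb]
      exact hc b hb
    · simp only [hz, if_neg hb]
      positivity
  have hsum : ∑ b ∈ s, z b ≤ y + ∑ b ∈ N, c b := by
    rw [← sum_sdiff hN, sum_congr rfl hzN, sum_congr rfl hzs, sum_const, nsmul_eq_mul]
    gcongr
    rcases eq_or_ne ((s \ N).card : ℝ) 0 with h0 | h0
    · simpa [h0] using hy
    · exact (mul_div_cancel₀ _ h0).le
  calc (∏ b ∈ N, c b) * (y / ((s \ N).card : ℝ)) ^ (s \ N).card = ∏ b ∈ s, z b := by
        rw [← prod_sdiff hN, prod_congr rfl hzN, prod_congr rfl hzs, prod_const, mul_comm]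
    _ ≤ ((∑ b ∈ s, z b) / (s.card : ℝ)) ^ s.card := prod_le_sum_div_card_pow s z hz0
    _ ≤ _ := by
        have := sum_nonneg hz0
        gcongr

/-- In a rainbow graph the color of an edge at `s` determines its other endpoint. -/
lemma rainbowOf_left_cancel {k : ℕ} {G : SimpleGraph (Fin k)} {s b c : Fin k}
    (hb : G.Adj s b) (h : rainbowOf G s b = rainbowOf G s c) : b = c := by
  by_cases hc : G.Adj s c
  · simp only [rainbowOf, if_pos hb, if_pos hc] at h
    have hmem : b ∈ ({s, c} : Finset (Fin k)) := h ▸ (by simp)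
    simpa [hb.ne'] using hmem
  · simp [rainbowOf, hb, hc] at h

/-- A color `{i, j}` is seen only at its own endpoints. -/
lemma rainbowOf_ne_pair {k : ℕ} {G : SimpleGraph (Fin k)} {a b i j : Fin k}
    (hi : a ≠ i) (hj : a ≠ j) : rainbowOf G a b ≠ {i, j} := by
  intro h
  by_cases hab : G.Adj a b
  · simp only [rainbowOf, if_pos hab] at h
    have hmem : a ∈ ({i, j} : Finset (Fin k)) := h ▸ (by simp)
    simp [hi, hj] at hmem
  · simp only [rainbowOf, if_neg hab] at h
    exact (insert_ne_empty i {j}) h.symm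

/-- The color-preserving maps that agree with `ψ` on `S` and send all other vertices into `W`. -/
noncomputable def extensions {k n : ℕ} (R : Fin k → Fin k → Finset (Fin k))
    (χ : Fin n → Fin n → Finset (Fin k)) (S : Finset (Fin k)) (ψ : Fin k → Fin n)
    (W : Finset (Fin n)) : Finset (Fin k → Fin n) :=
  univ.filter fun φ => (∀ s ∈ S, φ s = ψ s) ∧ (∀ b ∉ S, φ b ∈ W) ∧
    ∀ a b : Fin k, a ≠ b → χ (φ a) (φ b) = R a b

/-- A partial map prescribed on a nonempty set `S` has at most `(|W| / |Sᶜ|) ^ |Sᶜ|` extensions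
into `W`: the candidate sets of the vertices adjacent to `S` are pairwise disjoint, and no vertex at
distance more than one from `S` can be sent to any of them. -/
lemma card_extensions_le {k n : ℕ} {G : SimpleGraph (Fin k)} (hG : G.Connected)
    (χ : Fin n → Fin n → Finset (Fin k)) (S : Finset (Fin k)) (hS : S.Nonempty)
    (ψ : Fin k → Fin n) (W : Finset (Fin n)) :
    ((extensions (rainbowOf G) χ S ψ W).card : ℝ) ≤ ((W.card : ℝ) / (Sᶜ.card : ℝ)) ^ Sᶜ.card := by
  induction hm : Sᶜ.card using Nat.strong_induction_on generalizing S ψ W with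
  | _ m ih =>
  rcases Sᶜ.eq_empty_or_nonempty with hSc | ⟨v, hv⟩
  · have hm0 : m = 0 := by rw [← hm, hSc, card_empty]
    have hall : ∀ a, a ∈ S := fun a => by
      by_contra h
      have : a ∈ Sᶜ := mem_compl.2 h
      simp [hSc] at this
    subst hm0
    rw [pow_zero]
    have hle : (extensions (rainbowOf G) χ S ψ W).card ≤ 1 := by
      refine card_le_one.2 fun φ hφ φ' hφ' => ?_
      simp only [extensions, mem_filter] at hφ hφ'
      funext a
      rw [hφ.2.1 a (hall a), hφ'.2.1 a (hall a)]
    exact_mod_cast hle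
  obtain ⟨u, hu⟩ := hS
  obtain ⟨p⟩ := hG.preconnected u v
  obtain ⟨d, -, hd1, hd2⟩ := p.exists_boundary_dart (S : Set (Fin k)) hu (by simpa using hv)
  set N : Finset (Fin k) := univ.filter fun b => b ∉ S ∧ ∃ s ∈ S, G.Adj s b with hN
  have hmemN : ∀ b, b ∈ N ↔ b ∉ S ∧ ∃ s ∈ S, G.Adj s b := fun b => by simp [hN]
  set cand : Fin k → Finset (Fin n) := fun b =>
    W.filter fun z => ∀ s ∈ S, χ (ψ s) z = rainbowOf G s b
  have hdisj : (N : Set (Fin k)).PairwiseDisjoint cand := by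
    intro b hb c _ hbc
    refine disjoint_left.2 fun z hzb hzc => hbc ?_
    obtain ⟨-, s, hs, hadj⟩ := (hmemN b).1 hb
    exact rainbowOf_left_cancel hadj
      (((mem_filter.1 hzb).2 s hs).symm.trans ((mem_filter.1 hzc).2 s hs))
  have hsub : N.biUnion cand ⊆ W := biUnion_subset.2 fun b _ => filter_subset _ _
  set W' := W \ N.biUnion cand
  set Q : Finset (Fin k) := (S ∪ N)ᶜ with hQ
  have hdN : d.snd ∈ N := (hmemN _).2 ⟨hd2, d.fst, hd1, d.adj⟩
  have hNS : N ⊆ Sᶜ := fun b hb => mem_compl.2 ((hmemN b).1 hb).1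
  have hQS : Q = Sᶜ \ N := by
    ext b
    simp [hQ]
  have hlt : Q.card < m := by
    rw [← hm]
    refine card_lt_card ⟨by rw [hQS]; exact sdiff_subset, fun h => ?_⟩
    have := h (hNS hdN)
    rw [hQS] at this
    exact (mem_sdiff.1 this).2 hdN
  set t : Finset (Fin k → Fin n) :=
    Fintype.piFinset fun b => if b ∈ N then cand b else {ψ b} with ht
  have htcard : t.card = ∏ b ∈ N, (cand b).card := by
    rw [ht, Fintype.card_piFinset, ← prod_filter_mul_prod_filter_not univ (· ∈ N)]
    rw [prod_congr rfl (g := fun b => (cand b).card)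
        (fun b hb => by rw [if_pos (mem_filter.1 hb).2]),
      prod_congr (s₁ := univ.filter (¬ · ∈ N)) rfl (g := fun _ => 1)
        (fun b hb => by rw [if_neg (mem_filter.1 hb).2, card_singleton])]
    simp
  set f : (Fin k → Fin n) → (Fin k → Fin n) := fun φ b => if b ∈ N then φ b else ψ b with hf
  have hmaps : Set.MapsTo f (extensions (rainbowOf G) χ S ψ W) t := by
    intro φ hφ
    obtain ⟨-, hφS, hφW, hφχ⟩ := mem_filter.1 (mem_coe.1 hφ)
    refine mem_coe.2 (Fintype.mem_piFinset.2 fun b => ?_)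
    by_cases hb : b ∈ N
    · have hbS := ((hmemN b).1 hb).1
      simp only [hf, if_pos hb]
      refine mem_filter.2 ⟨hφW b hbS, fun s hs => ?_⟩
      rw [← hφS s hs]
      exact hφχ s b (fun h => hbS (h ▸ hs))
    · simp [hf, if_neg hb]
  have hfiber : ∀ ψ' ∈ t,
      (((extensions (rainbowOf G) χ S ψ W).filter fun φ => f φ = ψ').card : ℝ) ≤
        ((W'.card : ℝ) / (Q.card : ℝ)) ^ Q.card := by
    intro ψ' _
    refine le_trans ?_ (ih Q.card hlt (S ∪ N) ⟨u, mem_union_left _ hu⟩ ψ' W' rfl)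
    refine Nat.cast_le.2 (card_le_card fun φ hφ => ?_)
    obtain ⟨hφe, rfl⟩ := mem_filter.1 hφ
    obtain ⟨-, hφS, hφW, hφχ⟩ := mem_filter.1 hφe
    refine mem_filter.2 ⟨mem_univ _, fun s hs => ?_, fun c hc => ?_, hφχ⟩
    · by_cases hsN : s ∈ N
      · simp [hf, hsN]
      · simp only [hf, if_neg hsN]
        exact hφS s ((mem_union.1 hs).resolve_right hsN)
    · rw [mem_union, not_or] at hc
      refine mem_sdiff.2 ⟨hφW c hc.1, fun hmem => ?_⟩
      obtain ⟨b, hb, hbc⟩ := mem_biUnion.1 hmem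
      obtain ⟨-, s, hs, hadj⟩ := (hmemN b).1 hb
      have hχ := (mem_filter.1 hbc).2 s hs
      rw [← hφS s hs, hφχ s c (fun h => hc.1 (h ▸ hs))] at hχ
      exact hc.2 (rainbowOf_left_cancel hadj hχ.symm ▸ hb)
  have hWc : (W'.card : ℝ) + ∑ b ∈ N, ((cand b).card : ℝ) = W.card := by
    rw [← card_sdiff_add_card_eq_card hsub, card_biUnion hdisj, Nat.cast_add, Nat.cast_sum]
  have hmean := prod_mul_div_pow_le hNS (c := fun b => ((cand b).card : ℝ))
    (fun b _ => Nat.cast_nonneg _) (Nat.cast_nonneg (α := ℝ) W'.card)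
  rw [hWc, ← hQS, hm] at hmean
  refine le_trans ?_ hmean
  rw [card_eq_sum_card_fiberwise hmaps, Nat.cast_sum, ← Nat.cast_prod, ← htcard, ← nsmul_eq_mul]
  exact sum_le_card_nsmul _ _ _ hfiber

/-- Every copy of `R` through `x` comes from an embedding giving `x` some role. -/
lemma vertDeg_le_sum_embCount {k n : ℕ} {T : Type} (R : Fin k → Fin k → T)
    (χ : Fin n → Fin n → T) (x : Fin n) :
    vertDeg k n R χ x ≤ ∑ a, embCount k n R χ a x := by
  unfold vertDeg embCount
  refine le_trans ?_ card_biUnion_le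
  refine le_trans (card_le_card ?_) (card_image_le (f := fun φ : Fin k → Fin n => univ.image φ))
  intro S hS
  obtain ⟨hSk, hx, φ, hinj, hφS, hφ⟩ := mem_filter.1 hS
  have hSφ : univ.image φ = S := by
    refine eq_of_subset_of_card_le (image_subset_iff.2 fun a _ => hφS a) ?_
    rw [card_image_of_injective _ hinj, (mem_powersetCard.1 hSk).2]
    simp
  obtain ⟨a, -, ha⟩ := mem_image.1 (hSφ ▸ hx)
  exact mem_image.2 ⟨φ, mem_biUnion.2 ⟨a, mem_univ _, mem_filter.2 ⟨mem_univ _, hinj, ha, hφ⟩⟩, hSφ⟩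

/-- The vertices other than `x` that are not joined to `x` by the color `c`. -/
noncomputable def colorAvoiding {n : ℕ} {T : Type} (χ : Fin n → Fin n → T) (x : Fin n) (c : T) :
    Finset (Fin n) :=
  univ.filter fun y => y ≠ x ∧ χ x y ≠ c

lemma mem_colorAvoiding {n : ℕ} {T : Type} {χ : Fin n → Fin n → T} {x y : Fin n} {c : T} :
    y ∈ colorAvoiding χ x c ↔ y ≠ x ∧ χ x y ≠ c := by
  simp [colorAvoiding]

lemma card_colorAvoiding_add_colorDeg_le {n : ℕ} {T : Type} (χ : Fin n → Fin n → T) (x : Fin n)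
    (c : T) : (colorAvoiding χ x c).card + colorDeg χ x c ≤ n := by
  unfold colorAvoiding colorDeg
  rw [← card_union_of_disjoint]
  · exact (card_le_univ _).trans_eq (Fintype.card_fin n)
  · exact disjoint_filter.2 fun y _ h1 h2 => h1.2 h2.2

/-- A finite set containing all embeddings with `x` in role `i` bounds their number. -/
lemma embCount_le_card {k n : ℕ} {T : Type} {R : Fin k → Fin k → T} {χ : Fin n → Fin n → T}
    {i : Fin k} {x : Fin n} {F : Finset (Fin k → Fin n)}
    (hF : ∀ φ : Fin k → Fin n, Function.Injective φ → φ i = x →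
      (∀ a b : Fin k, a ≠ b → χ (φ a) (φ b) = R a b) → φ ∈ F) :
    embCount k n R χ i x ≤ F.card := by
  refine card_le_card fun φ hφ => ?_
  obtain ⟨-, hinj, hix, hφχ⟩ := mem_filter.1 hφ
  exact hF φ hinj hix hφχ

/-- A copy in which the role of `x` is not an endpoint of `ij` avoids the color `{i, j}` at `x`. -/
lemma embCount_le_of_ne {k n : ℕ} {G : SimpleGraph (Fin k)} (hG : G.Connected)
    (χ : Fin n → Fin n → Finset (Fin k)) (x : Fin n) {a i j : Fin k} (hi : a ≠ i) (hj : a ≠ j) :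
    (embCount k n (rainbowOf G) χ a x : ℝ) ≤
      (((colorAvoiding χ x {i, j}).card : ℝ) / ((k - 1 : ℕ) : ℝ)) ^ (k - 1) := by
  have hext := card_extensions_le hG χ {a} (singleton_nonempty a) (fun _ => x)
    (colorAvoiding χ x {i, j})
  rw [card_compl, card_singleton, Fintype.card_fin] at hext
  refine le_trans (Nat.cast_le.2 (embCount_le_card fun φ hinj hax hφχ => ?_)) hext
  refine mem_filter.2 ⟨mem_univ _, by simpa using hax, fun b hb => ?_, hφχ⟩
  have hba : b ≠ a := by simpa using hb
  refine mem_colorAvoiding.2 ⟨hax ▸ hinj.ne hba, ?_⟩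
  rw [← hax, hφχ a b hba.symm]
  exact rainbowOf_ne_pair hi hj

/-- In a copy with `x` in role `i`, exactly one vertex is joined to `x` by the color `{i, j}`. -/
lemma embCount_le_of_adj {k n : ℕ} {G : SimpleGraph (Fin k)} (hG : G.Connected)
    (χ : Fin n → Fin n → Finset (Fin k)) (x : Fin n) {i j : Fin k} (hij : G.Adj i j) :
    (embCount k n (rainbowOf G) χ i x : ℝ) ≤
      n * (((colorAvoiding χ x {i, j}).card : ℝ) / ((k - 2 : ℕ) : ℝ)) ^ (k - 2) := by
  set ψ : Fin n → Fin k → Fin n := fun y b => if b = i then x else y with hψ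
  set W := colorAvoiding χ x ({i, j} : Finset (Fin k))
  have hsub : embCount k n (rainbowOf G) χ i x ≤
      (univ.biUnion fun y => extensions (rainbowOf G) χ {i, j} (ψ y) W).card := by
    refine embCount_le_card fun φ hinj hix hφχ => ?_
    refine mem_biUnion.2 ⟨φ j, mem_univ _, mem_filter.2 ⟨mem_univ _, ?_, fun b hb => ?_, hφχ⟩⟩
    · simp [hψ, hix, hij.ne']
    · simp only [mem_insert, mem_singleton, not_or] at hb
      refine mem_colorAvoiding.2 ⟨hix ▸ hinj.ne hb.1, fun h => hb.2 ?_⟩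
      rw [← hix, hφχ i b (Ne.symm hb.1)] at h
      refine (rainbowOf_left_cancel hij ?_).symm
      rw [h, rainbowOf, if_pos hij]
  calc (embCount k n (rainbowOf G) χ i x : ℝ)
      ≤ ((∑ y : Fin n, (extensions (rainbowOf G) χ {i, j} (ψ y) W).card : ℕ) : ℝ) :=
        Nat.cast_le.2 (hsub.trans card_biUnion_le)
    _ ≤ ∑ _y : Fin n, ((W.card : ℝ) / ((k - 2 : ℕ) : ℝ)) ^ (k - 2) := by
        push_cast
        refine sum_le_sum fun y _ => ?_
        have hext := card_extensions_le hG χ {i, j} (insert_nonempty _ _) (ψ y) W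
        rwa [card_compl, card_pair hij.ne, Fintype.card_fin] at hext
    _ = _ := by simp

/-- `(1 / (k - r)) ^ (k - r)` is at most `3 ^ r / k ^ (k - r)`. -/
lemma one_div_sub_pow_le {k r : ℕ} (hr : r < k) :
    (1 / ((k - r : ℕ) : ℝ)) ^ (k - r) ≤ 3 ^ r / (k : ℝ) ^ (k - r) := by
  have hm : (0 : ℝ) < ((k - r : ℕ) : ℝ) := by exact_mod_cast Nat.sub_pos_of_lt hr
  have hk : (0 : ℝ) < k := by exact_mod_cast (Nat.zero_le r).trans_lt hr
  have hkr : (k : ℝ) = ((k - r : ℕ) : ℝ) + r := by exact_mod_cast (Nat.sub_add_cancel hr.le).symm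
  rw [le_div_iff₀ (by positivity), ← mul_pow]
  calc (1 / ((k - r : ℕ) : ℝ) * k) ^ (k - r)
      ≤ (Real.exp (r / ((k - r : ℕ) : ℝ))) ^ (k - r) := by
        refine pow_le_pow_left₀ (by positivity) ?_ _
        have h := Real.add_one_le_exp ((r : ℝ) / ((k - r : ℕ) : ℝ))
        have he : 1 / ((k - r : ℕ) : ℝ) * k = r / ((k - r : ℕ) : ℝ) + 1 := by
          rw [one_div_mul_eq_div, div_add_one hm.ne', add_comm, ← hkr]
        rwa [he]
    _ = (Real.exp 1) ^ r := by
        rw [← Real.exp_nat_mul, ← Real.exp_nat_mul]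
        congr 1
        field_simp
    _ ≤ 3 ^ r := pow_le_pow_left₀ (Real.exp_pos 1).le Real.exp_one_lt_three.le _

/-- for suitable absolute constants `C > 0` and `k₀`, in any `H` whose vertices all
satisfy `d(x) ≥ n^{k−1}/(k^{k−1}−1)` (with respect to a connected rainbow graph `R` on `[k]`,
`k ≥ k₀`, of minimum degree at least `η(k−1)` where `C log k/(k−1) < η ≤ 1`), every color degree
at an edge of `R` is less than `η·n/4`. -/
theorem max_color_degree_sparse :
    ∃ C : ℝ, 0 < C ∧ ∃ k₀ : ℕ, ∀ k : ℕ, k₀ ≤ k → ∀ η : ℝ,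
      C * Real.log k / ((k : ℝ) - 1) < η → η ≤ 1 →
      ∀ G : SimpleGraph (Fin k), G.Connected →
      (∀ i : Fin k, η * ((k : ℝ) - 1) ≤ (degR G i : ℝ)) →
      ∀ n : ℕ, ∀ χ : Fin n → Fin n → Finset (Fin k), IsSym χ →
      (∀ x : Fin n,
        (n : ℝ) ^ (k - 1) / ((k : ℝ) ^ (k - 1) - 1) ≤ (vertDeg k n (rainbowOf G) χ x : ℝ)) →
      ∀ x : Fin n, ∀ i j : Fin k, G.Adj i j →
        (colorDeg χ x ({i, j} : Finset (Fin k)) : ℝ) < η * (n : ℝ) / 4 := by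
  refine ⟨48, by norm_num, 10, ?_⟩
  intro k hk η hη _ G hG _ n χ _ hdeg x i j hij
  by_contra! hD
  have hk10 : (10 : ℝ) ≤ k := by exact_mod_cast hk
  have hn : (0 : ℝ) < n := by exact_mod_cast x.pos
  rw [div_lt_iff₀ (by linarith)] at hη
  have hlog : 0 < Real.log k := Real.log_pos (by linarith)
  have hη0 : 0 < η := by
    by_contra! h
    nlinarith
  set w : ℝ := ((colorAvoiding χ x ({i, j} : Finset (Fin k))).card : ℝ) with hw
  have hw0 : 0 ≤ w := Nat.cast_nonneg _
  have hwD : w + (colorDeg χ x ({i, j} : Finset (Fin k)) : ℝ) ≤ n := by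
    rw [hw]
    exact_mod_cast card_colorAvoiding_add_colorDeg_le χ x ({i, j} : Finset (Fin k))
  have hwn : w ≤ n := by
    have : (0 : ℝ) ≤ (colorDeg χ x ({i, j} : Finset (Fin k)) : ℝ) := Nat.cast_nonneg _
    linarith
  have hwexp : w ≤ n * Real.exp (-(η / 4)) := by
    have h := Real.add_one_le_exp (-(η / 4))
    nlinarith
  have hcast : ((k - 2 : ℕ) : ℝ) = (k : ℝ) - 2 := by
    rw [Nat.cast_sub (by omega)]
    norm_num
  have hpow2 : w ^ (k - 2) ≤ (n : ℝ) ^ (k - 2) / (k : ℝ) ^ 6 := by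
    calc w ^ (k - 2) ≤ (n * Real.exp (-(η / 4))) ^ (k - 2) := pow_le_pow_left₀ hw0 hwexp _
      _ = (n : ℝ) ^ (k - 2) * Real.exp (((k - 2 : ℕ) : ℝ) * (-(η / 4))) := by
          rw [mul_pow, ← Real.exp_nat_mul]
      _ ≤ (n : ℝ) ^ (k - 2) * Real.exp (-(6 * Real.log k)) := by
          gcongr
          rw [hcast]
          nlinarith
      _ = (n : ℝ) ^ (k - 2) / (k : ℝ) ^ 6 := by
          rw [Real.exp_neg, show 6 * Real.log k = ((6 : ℕ) : ℝ) * Real.log k by norm_num,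
            Real.exp_nat_mul, Real.exp_log (by linarith), div_eq_mul_inv]
  have hsucc : k - 1 = k - 2 + 1 := by omega
  have hpow1 : w ^ (k - 1) ≤ (n : ℝ) ^ (k - 1) / (k : ℝ) ^ 6 := by
    rw [hsucc, pow_succ, pow_succ]
    calc w ^ (k - 2) * w ≤ (n : ℝ) ^ (k - 2) / (k : ℝ) ^ 6 * n := by gcongr
      _ = _ := by ring
  set M : ℝ := (n : ℝ) ^ (k - 1) / (k : ℝ) ^ (k - 1) with hM
  have hM0 : 0 < M := by positivity
  have hother : (w / ((k - 1 : ℕ) : ℝ)) ^ (k - 1) ≤ 9 * M / (k : ℝ) ^ 5 := by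
    calc (w / ((k - 1 : ℕ) : ℝ)) ^ (k - 1) = w ^ (k - 1) * (1 / ((k - 1 : ℕ) : ℝ)) ^ (k - 1) := by
          rw [← mul_pow, mul_one_div]
      _ ≤ (n : ℝ) ^ (k - 1) / (k : ℝ) ^ 6 * (3 ^ 1 / (k : ℝ) ^ (k - 1)) := by
          gcongr
          exact one_div_sub_pow_le (by omega)
      _ = 3 * M / k * (1 / (k : ℝ) ^ 5) := by
          rw [hM]
          field_simp
      _ ≤ 9 * M * (1 / (k : ℝ) ^ 5) := by
          gcongr
          rw [div_le_iff₀ (by linarith)]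
          nlinarith
      _ = _ := by ring
  have hend : n * (w / ((k - 2 : ℕ) : ℝ)) ^ (k - 2) ≤ 9 * M / (k : ℝ) ^ 5 := by
    calc n * (w / ((k - 2 : ℕ) : ℝ)) ^ (k - 2)
        = n * (w ^ (k - 2) * (1 / ((k - 2 : ℕ) : ℝ)) ^ (k - 2)) := by
          rw [← mul_pow, mul_one_div]
      _ ≤ n * ((n : ℝ) ^ (k - 2) / (k : ℝ) ^ 6 * (3 ^ 2 / (k : ℝ) ^ (k - 2))) := by
          gcongr
          exact one_div_sub_pow_le (by omega)
      _ = 9 * M / (k : ℝ) ^ 5 := by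
          rw [hM, hsucc, pow_succ, pow_succ]
          field_simp
          ring
  have hemb : ∀ a, (embCount k n (rainbowOf G) χ a x : ℝ) ≤ 9 * M / (k : ℝ) ^ 5 := by
    intro a
    by_cases hai : a = i
    · subst hai
      exact (embCount_le_of_adj hG χ x hij).trans hend
    by_cases haj : a = j
    · subst haj
      have h := embCount_le_of_adj hG χ x hij.symm
      rw [pair_comm] at h
      exact h.trans hend
    exact (embCount_le_of_ne hG χ x hai haj).trans hother
  have hvert : (vertDeg k n (rainbowOf G) χ x : ℝ) ≤ k * (9 * M / (k : ℝ) ^ 5) := by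
    calc (vertDeg k n (rainbowOf G) χ x : ℝ)
        ≤ ∑ a, (embCount k n (rainbowOf G) χ a x : ℝ) := by
          exact_mod_cast vertDeg_le_sum_embCount (rainbowOf G) χ x
      _ ≤ ∑ _a : Fin k, 9 * M / (k : ℝ) ^ 5 := sum_le_sum fun a _ => hemb a
      _ = _ := by simp
  have hsmall : k * (9 * M / (k : ℝ) ^ 5) < M := by
    have hk4 : (10 : ℝ) ≤ (k : ℝ) ^ 4 := hk10.trans (le_self_pow₀ (by linarith) (by norm_num))
    rw [show k * (9 * M / (k : ℝ) ^ 5) = 9 * M / (k : ℝ) ^ 4 by field_simp,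
      div_lt_iff₀ (by positivity)]
    nlinarith
  have hMle : M ≤ (n : ℝ) ^ (k - 1) / ((k : ℝ) ^ (k - 1) - 1) := by
    have : 1 < (k : ℝ) ^ (k - 1) := one_lt_pow₀ (by linarith) (by omega)
    refine div_le_div_of_nonneg_left (by positivity) (by linarith) (by linarith)
  linarith [hdeg x]
end

section
/- Let R be a rainbow graph on k vertices, viewed as a T-edge-colored complete graph with non-edge color ∅, whose connected components have c_1, …, c_ℓ vertices with every c_i ≥ 2 (so c_1 + ⋯ + c_ℓ = k). Then for every n ≥ k, I(R,n) ≥ k! · (∏_{i=1}^{ℓ} 1/(k^{c_i} − k·(k/c_i)^{c_i−1})) · binom(n,k). (This construction takes disjoint iterated balanced blow-ups of the components, placed on parts of sizes proportional to c_i; when ℓ ≥ 2 it witnesses that disconnected rainbow graphs without isolated vertices are not fractalizers.) -/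
open Finset Filter

open scoped Classical

/-- The number of vertices of the connected component `c` of `G`. -/
noncomputable def compCard {k : ℕ} (G : SimpleGraph (Fin k)) (c : G.ConnectedComponent) : ℕ :=
  ((Finset.univ : Finset (Fin k)).filter (fun v => G.connectedComponentMk v = c)).card

/-- The probability of the event `P` under the uniform distribution on `α`. -/
noncomputable def unifProb {α : Type} (P : α → Prop) : ℝ :=
  (Nat.card {a // P a} : ℝ) / Nat.card α

theorem unifProb_congr_equiv {α β : Type} (e : α ≃ β) {P : α → Prop} {Q : β → Prop}
    (h : ∀ a, P a ↔ Q (e a)) : unifProb P = unifProb Q := by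
  unfold unifProb
  rw [Nat.card_congr e, Nat.card_congr (e.subtypeEquiv h)]

theorem unifProb_pi {ι : Type} [Fintype ι] {α : ι → Type} (P : ∀ i, α i → Prop) :
    unifProb (fun f : ∀ i, α i => ∀ i, P i (f i)) = ∏ i, unifProb (P i) := by
  unfold unifProb
  rw [Nat.card_congr Equiv.subtypePiEquivPi, Nat.card_pi, Nat.card_pi]
  push_cast
  rw [Finset.prod_div_distrib]

theorem unifProb_prod {α β : Type} (P : α → Prop) (Q : β → Prop) :
    unifProb (fun x : α × β => P x.1 ∧ Q x.2) = unifProb P * unifProb Q := by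
  unfold unifProb
  rw [Nat.card_congr Equiv.subtypeProdEquivProd, Nat.card_prod, Nat.card_prod]
  push_cast
  rw [mul_div_mul_comm]

theorem unifProb_or {α : Type} [Finite α] {P Q : α → Prop} (h : ∀ a, P a → ¬ Q a) :
    unifProb (fun a => P a ∨ Q a) = unifProb P + unifProb Q := by
  unfold unifProb
  have hd : Disjoint P Q := by
    rw [Pi.disjoint_iff]
    intro a
    rw [Prop.disjoint_iff]
    have := h a
    tauto
  rw [Nat.card_congr (subtypeOrEquiv P Q hd), Nat.card_sum]
  push_cast
  rw [add_div]

theorem unifProb_true {α : Type} [Finite α] [Nonempty α] :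
    unifProb (fun _ : α => True) = 1 := by
  unfold unifProb
  rw [Nat.card_congr (Equiv.subtypeUnivEquiv fun _ => trivial)]
  exact div_self (by exact_mod_cast Nat.card_pos.ne')

theorem unifProb_fst {α β : Type} [Finite β] [Nonempty β] (P : α → Prop) :
    unifProb (fun x : α × β => P x.1) = unifProb P := by
  have := unifProb_prod P (fun _ : β => True)
  simpa [unifProb_true] using this

theorem unifProb_eval {ι : Type} [Finite ι] {α : ι → Type} [∀ i, Finite (α i)]
    [∀ i, Nonempty (α i)] (i : ι) (P : α i → Prop) :
    unifProb (fun f : ∀ i, α i => P (f i)) = unifProb P := by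
  rw [← unifProb_fst (β := ∀ j : {j // j ≠ i}, α j) P]
  exact unifProb_congr_equiv (Equiv.piSplitAt i α) fun f => by simp [Equiv.piSplitAt]

theorem unifProb_comp_injective {ι κ α : Type} [Finite ι] [Finite α] [Nonempty α]
    {φ : κ → ι} (hφ : Function.Injective φ) (P : (κ → α) → Prop) :
    unifProb (fun w : ι → α => P (w ∘ φ)) = unifProb P := by
  have h := unifProb_fst (β := {i // i ∉ Set.range φ} → α)
    (fun u : {i // i ∈ Set.range φ} → α => P (u ∘ Equiv.ofInjective φ hφ))
  rw [← unifProb_congr_equiv (Equiv.piEquivPiSubtypeProd (· ∈ Set.range φ) fun _ => α)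
    (P := fun w : ι → α => P (w ∘ φ)) fun w => Iff.rfl] at h
  rw [h]
  refine unifProb_congr_equiv ((Equiv.ofInjective φ hφ).symm.arrowCongr (Equiv.refl α)) fun u => ?_
  rfl

/-- In a sequence of `D` independent samples, the probability that some sample satisfies `P`
and all earlier ones satisfy the disjoint event `Q` is a geometric sum. -/
theorem unifProb_first_hit {Y : Type} [Finite Y] [Nonempty Y] {P Q : Y → Prop}
    (h : ∀ y, P y → ¬ Q y) (D : ℕ) :
    unifProb (fun t : Fin D → Y => ∃ d, P (t d) ∧ ∀ e < d, Q (t e)) =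
      unifProb P * ∑ j ∈ range D, unifProb Q ^ j := by
  induction D with
  | zero => simp [unifProb]
  | succ D ih =>
    rw [Finset.sum_range_succ', unifProb_congr_equiv (Fin.consEquiv fun _ => Y).symm
      (Q := fun x : Y × (Fin D → Y) => P x.1 ∨
        (Q x.1 ∧ ∃ d, P (x.2 d) ∧ ∀ e < d, Q (x.2 e))),
      unifProb_or, unifProb_fst,
      unifProb_prod Q fun t : Fin D → Y => ∃ d, P (t d) ∧ ∀ e < d, Q (t e),
      ih]
    · simp only [pow_succ, ← Finset.sum_mul]
      ring
    · exact fun a ha hb => h _ ha hb.1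
    · intro t
      simp only [Fin.exists_fin_succ, Fin.forall_fin_succ, Fin.consEquiv, Equiv.coe_fn_symm_mk]
      simp only [Fin.tail, Fin.not_lt_zero, Fin.succ_pos, Fin.succ_lt_succ_iff, IsEmpty.forall_iff,
        implies_true, and_true, forall_const]
      grind

/-- The vertices of the connected component `C`. -/
abbrev CompVert {k : ℕ} (G : SimpleGraph (Fin k)) (C : G.ConnectedComponent) : Type :=
  {v : Fin k // G.connectedComponentMk v = C}

theorem natCard_compVert {k : ℕ} (G : SimpleGraph (Fin k)) (C : G.ConnectedComponent) :
    Nat.card (CompVert G C) = compCard G C := by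
  rw [Nat.card_eq_fintype_card, Fintype.card_subtype, compCard]

instance {k : ℕ} (G : SimpleGraph (Fin k)) (C : G.ConnectedComponent) :
    Nonempty (CompVert G C) :=
  let ⟨v, hv⟩ := C.exists_rep
  ⟨⟨v, hv⟩⟩

/-- Addresses of vertices in the depth-`D` blow-up: the first entry selects a component (with
probability proportional to its size), the second one gives a word of length `D` in every
component, of which only the word in the selected component matters. -/
abbrev BlowWord {k : ℕ} (G : SimpleGraph (Fin k)) (D : ℕ) : Type :=
  Fin k × (∀ C : G.ConnectedComponent, Fin D → CompVert G C)

/-- The word of `ω` in the component selected by `ω`. -/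
def BlowWord.label {k D : ℕ} {G : SimpleGraph (Fin k)} (ω : BlowWord G D) (d : Fin D) : Fin k :=
  ω.2 (G.connectedComponentMk ω.1) d

/-- The color of a pair of words: the color in `G` of the pair of letters at the first position
at which the words differ. -/
noncomputable def wordColor {k D : ℕ} (G : SimpleGraph (Fin k)) (a b : Fin D → Fin k) :
    Finset (Fin k) :=
  univ.filter fun x => ∃ d, (∀ e < d, a e = b e) ∧ x ∈ rainbowOf G (a d) (b d)

theorem rainbowOf_comm {k : ℕ} (G : SimpleGraph (Fin k)) (i j : Fin k) :
    rainbowOf G i j = rainbowOf G j i := by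
  simp only [rainbowOf, G.adj_comm i j, Finset.pair_comm i j]

theorem rainbowOf_self {k : ℕ} (G : SimpleGraph (Fin k)) (i : Fin k) : rainbowOf G i i = ∅ := by
  simp [rainbowOf]

theorem rainbowOf_eq_empty_of_ne {k : ℕ} {G : SimpleGraph (Fin k)} {i j : Fin k}
    (h : G.connectedComponentMk i ≠ G.connectedComponentMk j) : rainbowOf G i j = ∅ :=
  if_neg fun hadj => h (SimpleGraph.ConnectedComponent.eq.2 hadj.reachable)

theorem wordColor_comm {k D : ℕ} (G : SimpleGraph (Fin k)) (a b : Fin D → Fin k) :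
    wordColor G a b = wordColor G b a := by
  unfold wordColor
  simp only [rainbowOf_comm G (a _), eq_comm (a := a _)]

theorem wordColor_eq_of_first_diff {k D : ℕ} {G : SimpleGraph (Fin k)} {a b : Fin D → Fin k}
    {d : Fin D} (he : ∀ e < d, a e = b e) (hd : a d ≠ b d) :
    wordColor G a b = rainbowOf G (a d) (b d) := by
  ext x
  simp only [wordColor, mem_filter, mem_univ, true_and]
  refine ⟨?_, fun h => ⟨d, he, h⟩⟩
  rintro ⟨d', he', h⟩
  rcases lt_trichotomy d d' with hlt | rfl | hlt
  · exact absurd (he' d hlt) hd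
  · exact h
  · rw [he d' hlt, rainbowOf_self] at h
    simp at h

theorem BlowWord.connectedComponentMk_label {k D : ℕ} {G : SimpleGraph (Fin k)}
    (ω : BlowWord G D) (d : Fin D) :
    G.connectedComponentMk (BlowWord.label ω d) = G.connectedComponentMk ω.1 :=
  (ω.2 (G.connectedComponentMk ω.1) d).2

theorem BlowWord.label_eq {k D : ℕ} {G : SimpleGraph (Fin k)} {ω : BlowWord G D}
    {C : G.ConnectedComponent} (h : G.connectedComponentMk ω.1 = C) (d : Fin D) :
    BlowWord.label ω d = ω.2 C d := by
  subst h; rfl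

/-- The words `u v`, `v ∈ C`, lie in the component `C`, agree up to some position, and at
that position the letter of `u v` is `v`. -/
def IsCopyOn {k D : ℕ} {G : SimpleGraph (Fin k)} (C : G.ConnectedComponent)
    (u : CompVert G C → BlowWord G D) : Prop :=
  (∀ v, G.connectedComponentMk (u v).1 = C) ∧
    ∃ d, (∀ v, (u v).2 C d = v) ∧ ∀ e < d, ∀ v v', (u v).2 C e = (u v').2 C e

/-- The family of words `w` is a canonical copy of `G`, component by component. -/
def IsCanonicalCopy {k D : ℕ} {G : SimpleGraph (Fin k)} (w : Fin k → BlowWord G D) : Prop :=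
  ∀ C : G.ConnectedComponent, IsCopyOn C fun v => w v

theorem IsCanonicalCopy.wordColor_eq {k D : ℕ} {G : SimpleGraph (Fin k)}
    {w : Fin k → BlowWord G D} (hw : IsCanonicalCopy w) {i j : Fin k} (hij : i ≠ j) :
    wordColor G (BlowWord.label (w i)) (BlowWord.label (w j)) = rainbowOf G i j := by
  have htag : ∀ i, G.connectedComponentMk (w i).1 = G.connectedComponentMk i :=
    fun i => (hw _).1 ⟨i, rfl⟩
  by_cases hc : G.connectedComponentMk j = G.connectedComponentMk i
  · obtain ⟨-, d, hd, he⟩ := hw (G.connectedComponentMk i)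
    have hi : BlowWord.label (w i) d = i := by
      rw [BlowWord.label_eq (htag i), hd ⟨i, rfl⟩]
    have hj : BlowWord.label (w j) d = j := by
      rw [BlowWord.label_eq ((htag j).trans hc), hd ⟨j, hc⟩]
    rw [wordColor_eq_of_first_diff (d := d) _ (by rwa [hi, hj]), hi, hj]
    intro e hlt
    rw [BlowWord.label_eq (htag i), BlowWord.label_eq ((htag j).trans hc),
      he e hlt ⟨i, rfl⟩ ⟨j, hc⟩]
  · rw [rainbowOf_eq_empty_of_ne (Ne.symm hc)]
    refine Finset.filter_eq_empty_iff.2 fun x _ => ?_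
    rintro ⟨d, -, hx⟩
    rw [rainbowOf_eq_empty_of_ne] at hx
    · simp at hx
    · rw [BlowWord.connectedComponentMk_label, BlowWord.connectedComponentMk_label, htag, htag]
      exact Ne.symm hc

/-- A vertex set carries at most one canonical copy. -/
theorem IsCanonicalCopy.unique {k n D : ℕ} {G : SimpleGraph (Fin k)}
    (hcomp : ∀ c : G.ConnectedComponent, 2 ≤ compCard G c)
    {w : Fin n → BlowWord G D} {φ ψ : Fin k → Fin n}
    (hφ : IsCanonicalCopy (w ∘ φ)) (hψ : IsCanonicalCopy (w ∘ ψ))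
    (himg : Set.range φ = Set.range ψ) : φ = ψ := by
  funext i
  set C := G.connectedComponentMk i with hC
  obtain ⟨tφ, d, hd, he⟩ := hφ C
  obtain ⟨tψ, d', hd', he'⟩ := hψ C
  have key : ∀ {φ ψ : Fin k → Fin n}, IsCanonicalCopy (w ∘ φ) → IsCanonicalCopy (w ∘ ψ) →
      Set.range φ = Set.range ψ → ∀ v : CompVert G C, ∃ v' : CompVert G C, φ v = ψ v' := by
    intro φ ψ hφ hψ himg v
    obtain ⟨j, hj⟩ : φ v ∈ Set.range ψ := himg ▸ Set.mem_range_self _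
    refine ⟨⟨j, ?_⟩, hj.symm⟩
    have h1 := (hφ C).1 v
    have h2 := (hψ (G.connectedComponentMk j)).1 ⟨j, rfl⟩
    simp only [Function.comp_apply] at h1 h2
    rw [← h2, hj, h1]
  obtain ⟨v₁, v₂, hne⟩ : ∃ v₁ v₂ : CompVert G C, v₁ ≠ v₂ := by
    have : 1 < Nat.card (CompVert G C) := by
      rw [natCard_compVert]
      exact hcomp C
    have := Finite.one_lt_card_iff_nontrivial.1 this
    exact exists_pair_ne _
  have hdd : d = d' := by
    rcases lt_trichotomy d d' with hlt | h | hlt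
    · obtain ⟨u₁, h₁⟩ := key hφ hψ himg v₁
      obtain ⟨u₂, h₂⟩ := key hφ hψ himg v₂
      refine absurd ?_ hne
      rw [← hd v₁, ← hd v₂]
      simpa [h₁, h₂] using he' d hlt u₁ u₂
    · exact h
    · obtain ⟨u₁, h₁⟩ := key hψ hφ himg.symm v₁
      obtain ⟨u₂, h₂⟩ := key hψ hφ himg.symm v₂
      refine absurd ?_ hne
      rw [← hd' v₁, ← hd' v₂]
      simpa [h₁, h₂] using he d' hlt u₁ u₂
  subst hdd
  obtain ⟨v', hv'⟩ := key hφ hψ himg ⟨i, rfl⟩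
  have h1 := hd ⟨i, rfl⟩
  have h2 := hd' v'
  simp only [Function.comp_apply] at h1 h2 hv'
  rw [hv', h2] at h1
  rw [hv']
  exact congrArg (fun v : CompVert G C => ψ v) h1

/-- The blow-up coloring of `Fin n` obtained by placing its points at the words `w`. -/
noncomputable def blowColoring {k n D : ℕ} {G : SimpleGraph (Fin k)} (w : Fin n → BlowWord G D) :
    Fin n → Fin n → Finset (Fin k) :=
  fun x y => wordColor G (BlowWord.label (w x)) (BlowWord.label (w y))

theorem copyCount_le_maxCopyCount {T : Type} [Fintype T] {k n : ℕ} (R : Fin k → Fin k → T)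
    {χ : Fin n → Fin n → T} (hχ : IsSym χ) : copyCount k n R χ ≤ maxCopyCount k n R :=
  Finset.le_sup (f := fun χ => copyCount k n R χ) (mem_filter.2 ⟨mem_univ _, hχ⟩)

theorem natCard_canonicalCopy_le {k n D : ℕ} {G : SimpleGraph (Fin k)}
    (hcomp : ∀ c : G.ConnectedComponent, 2 ≤ compCard G c) (w : Fin n → BlowWord G D) :
    Nat.card {φ : Fin k ↪ Fin n // IsCanonicalCopy (w ∘ φ)} ≤
      maxCopyCount k n (rainbowOf G) := by
  refine le_trans ?_ (copyCount_le_maxCopyCount (χ := blowColoring w) _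
    fun x y => wordColor_comm G _ _)
  rw [copyCount, Nat.card_eq_fintype_card, Fintype.card_subtype]
  refine Finset.card_le_card_of_injOn (fun φ => univ.map φ) ?_ ?_
  · intro φ hφ
    simp only [coe_filter, mem_univ, true_and, Set.mem_ofPred_eq] at hφ
    simp only [coe_filter, Set.mem_ofPred_eq, mem_powersetCard]
    exact ⟨⟨subset_univ _, by simp⟩, φ, φ.injective, by simp,
      fun a b hab => hφ.wordColor_eq hab⟩
  · intro φ hφ ψ hψ h
    simp only [coe_filter, mem_univ, true_and, Set.mem_ofPred_eq] at hφ hψ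
    refine DFunLike.coe_injective (IsCanonicalCopy.unique hcomp hφ hψ ?_)
    simpa using congrArg (fun s : Finset (Fin n) => (s : Set (Fin n))) h

theorem unifProb_isCopyOn {k D : ℕ} {G : SimpleGraph (Fin k)} (C : G.ConnectedComponent)
    (hC : 2 ≤ compCard G C) :
    unifProb (IsCopyOn (D := D) C) =
      ((compCard G C : ℝ) / k) ^ compCard G C * (1 / (compCard G C : ℝ) ^ compCard G C *
        ∑ j ∈ range D, ((compCard G C : ℝ) / (compCard G C : ℝ) ^ compCard G C) ^ j) := by
  have hX := natCard_compVert G C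
  have hpair : unifProb (IsCopyOn (D := D) C) =
      unifProb (fun a : CompVert G C → Fin k => ∀ v, G.connectedComponentMk (a v) = C) *
      unifProb (fun b : CompVert G C → ∀ C' : G.ConnectedComponent, Fin D → CompVert G C' =>
        ∃ d, (∀ v, b v C d = v) ∧ ∀ e < d, ∀ v v', b v C e = b v' C e) := by
    rw [← unifProb_prod]
    exact unifProb_congr_equiv (Equiv.arrowProdEquivProdArrow _ _ _) fun u => Iff.rfl
  have htag : unifProb (fun a : CompVert G C → Fin k => ∀ v, G.connectedComponentMk (a v) = C) =
      ((compCard G C : ℝ) / k) ^ compCard G C := by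
    rw [unifProb_pi fun (_ : CompVert G C) (a : Fin k) => G.connectedComponentMk a = C,
      Finset.prod_const, Finset.card_univ, ← Nat.card_eq_fintype_card, hX, unifProb, hX,
      Nat.card_fin]
  have hwords : unifProb (fun b : CompVert G C → ∀ C' : G.ConnectedComponent,
        Fin D → CompVert G C' => ∃ d, (∀ v, b v C d = v) ∧ ∀ e < d, ∀ v v', b v C e = b v' C e) =
      unifProb (fun t : Fin D → CompVert G C → CompVert G C =>
        ∃ d, t d = id ∧ ∀ e < d, ∃ x, t e = fun _ => x) := by
    rw [unifProb_congr_equiv (Equiv.piComm _)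
      (P := fun b : CompVert G C → ∀ C' : G.ConnectedComponent, Fin D → CompVert G C' =>
        ∃ d, (∀ v, b v C d = v) ∧ ∀ e < d, ∀ v v', b v C e = b v' C e)
      (Q := fun b : ∀ C' : G.ConnectedComponent,
        CompVert G C → Fin D → CompVert G C' =>
        ∃ d, (∀ v, b C v d = v) ∧ ∀ e < d, ∀ v v', b C v e = b C v' e) fun _ => Iff.rfl,
      unifProb_eval (α := fun C' => CompVert G C → Fin D → CompVert G C') C
        fun b : CompVert G C → Fin D → CompVert G C =>
        ∃ d, (∀ v, b v d = v) ∧ ∀ e < d, ∀ v v', b v e = b v' e]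
    refine unifProb_congr_equiv (Equiv.piComm _) fun b => exists_congr fun d => and_congr ?_ ?_
    · exact funext_iff.symm
    · refine forall₂_congr fun e _ => ⟨fun h => ?_, ?_⟩
      · exact ⟨_, funext fun v => h v (Classical.arbitrary _)⟩
      · rintro ⟨x, hx⟩ v v'
        exact (congrFun hx v).trans (congrFun hx v').symm
  have hid : unifProb (fun f : CompVert G C → CompVert G C => f = id) =
      1 / (compCard G C : ℝ) ^ compCard G C := by
    rw [unifProb, Nat.card_fun, hX]
    simp
  have hconst : unifProb (fun f : CompVert G C → CompVert G C => ∃ x, f = fun _ => x) =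
      (compCard G C : ℝ) / (compCard G C : ℝ) ^ compCard G C := by
    have hinj : Function.Injective (Function.const (α := CompVert G C) (β := CompVert G C)) :=
      Function.const_injective
    have := Nat.card_congr (Equiv.ofInjective _ hinj)
    rw [unifProb, Nat.card_fun, hX, ← hX]
    push_cast
    congr 2
    rw [this]
    exact Nat.card_congr (Equiv.subtypeEquivRight fun f => by
      simp [Set.mem_range, eq_comm, Function.const_def])
  rw [hpair, htag, hwords, unifProb_first_hit (P := fun f : CompVert G C → CompVert G C => f = id)
    (Q := fun f => ∃ x, f = fun _ => x), hid, hconst]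
  rintro f rfl ⟨x, hx⟩
  have : Subsingleton (CompVert G C) :=
    ⟨fun a b => (congrFun hx a).trans (congrFun hx b).symm⟩
  have := Finite.card_le_one_iff_subsingleton.2 this
  omega

theorem unifProb_isCanonicalCopy {k D : ℕ} (G : SimpleGraph (Fin k)) :
    unifProb (IsCanonicalCopy (D := D) (G := G)) =
      ∏ C : G.ConnectedComponent, unifProb (IsCopyOn (D := D) C) := by
  rw [← unifProb_pi]
  refine unifProb_congr_equiv
    (((Equiv.sigmaFiberEquiv G.connectedComponentMk).arrowCongr (Equiv.refl _)).symm.trans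
      (Equiv.piCurry fun _ _ => BlowWord G D)) fun w => Iff.rfl

theorem descFactorial_mul_unifProb_le {k n D : ℕ} {G : SimpleGraph (Fin k)} [NeZero k]
    (hcomp : ∀ c : G.ConnectedComponent, 2 ≤ compCard G c) :
    (n.descFactorial k : ℝ) * unifProb (IsCanonicalCopy (D := D) (G := G)) ≤
      maxCopyCount k n (rainbowOf G) := by
  have hpos : (0 : ℝ) < Nat.card (Fin n → BlowWord G D) := by exact_mod_cast Nat.card_pos
  have hcount : ∑ φ : Fin k ↪ Fin n,
        Nat.card {w : Fin n → BlowWord G D // IsCanonicalCopy (w ∘ φ)} =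
      ∑ w : Fin n → BlowWord G D, Nat.card {φ : Fin k ↪ Fin n // IsCanonicalCopy (w ∘ φ)} := by
    simp only [Nat.card_eq_fintype_card, Fintype.card_subtype]
    exact Finset.sum_card_bipartiteAbove_eq_sum_card_bipartiteBelow _
  have hφ : ∀ φ : Fin k ↪ Fin n,
      (Nat.card {w : Fin n → BlowWord G D // IsCanonicalCopy (w ∘ φ)} : ℝ) =
        unifProb (IsCanonicalCopy (D := D) (G := G)) * Nat.card (Fin n → BlowWord G D) := by
    intro φ
    rw [← unifProb_comp_injective φ.injective, unifProb, div_mul_cancel₀ _ hpos.ne']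
  have hle : ∑ w : Fin n → BlowWord G D, Nat.card {φ : Fin k ↪ Fin n // IsCanonicalCopy (w ∘ φ)} ≤
      Nat.card (Fin n → BlowWord G D) * maxCopyCount k n (rainbowOf G) := by
    refine (Finset.sum_le_card_nsmul _ _ _ fun w _ => natCard_canonicalCopy_le hcomp w).trans ?_
    rw [Finset.card_univ, ← Nat.card_eq_fintype_card, smul_eq_mul]
  rw [← hcount] at hle
  have hle' := (Nat.cast_le (α := ℝ)).2 hle
  push_cast at hle'
  simp only [hφ, Finset.sum_const, Finset.card_univ, Fintype.card_embedding_eq, Fintype.card_fin,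
    nsmul_eq_mul] at hle'
  rw [← mul_assoc, mul_comm (_ : ℝ) (maxCopyCount _ _ _ : ℝ)] at hle'
  exact le_of_mul_le_mul_right hle' hpos

theorem tendsto_unifProb_isCopyOn {k : ℕ} {G : SimpleGraph (Fin k)} [NeZero k]
    (C : G.ConnectedComponent) (hC : 2 ≤ compCard G C) :
    Tendsto (fun D => unifProb (IsCopyOn (D := D) C)) atTop
      (nhds (1 / ((k : ℝ) ^ compCard G C -
        (k : ℝ) * ((k : ℝ) / (compCard G C : ℝ)) ^ (compCard G C - 1)))) := by
  simp only [unifProb_isCopyOn C hC]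
  have hk : (k : ℝ) ≠ 0 := Nat.cast_ne_zero.2 (NeZero.ne k)
  generalize compCard G C = c at hC
  obtain ⟨m, rfl⟩ : ∃ m, c = m + 2 := ⟨c - 2, by omega⟩
  have hc : (1 : ℝ) < ((m + 2 : ℕ) : ℝ) := by exact_mod_cast (by omega : 1 < m + 2)
  generalize ((m + 2 : ℕ) : ℝ) = x at hc
  have hx0 : (0 : ℝ) < x := by linarith
  have hxp : 1 < x ^ (m + 1) := one_lt_pow₀ hc (by omega)
  have hq : x / x ^ (m + 2) = 1 / x ^ (m + 1) := by
    field_simp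
    ring
  have hq1 : x / x ^ (m + 2) < 1 := by
    rw [hq, div_lt_one (by positivity)]
    exact hxp
  have hlim := (((hasSum_geometric_of_lt_one (by positivity) hq1).tendsto_sum_nat).const_mul
    (1 / x ^ (m + 2))).const_mul ((x / k) ^ (m + 2))
  convert hlim using 2
  have h1 : x ^ (m + 1) - 1 ≠ 0 := by linarith
  have h2 : (k : ℝ) ^ (m + 2) - k * (k / x) ^ (m + 1) =
      k ^ (m + 2) * (x ^ (m + 1) - 1) / x ^ (m + 1) := by
    rw [div_pow]
    field_simp
    ring
  have h3 : (1 - 1 / x ^ (m + 1)) = (x ^ (m + 1) - 1) / x ^ (m + 1) := by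
    field_simp
  rw [show m + 2 - 1 = m + 1 by omega, h2, hq, h3, div_pow]
  field_simp

/-- for a rainbow graph `R` on `k` vertices whose connected components all have
at least `2` vertices, and every `n ≥ k`,
`I(R,n) ≥ k!·(∏_c 1/(k^{c} − k·(k/c)^{c−1}))·binom(n,k)` where the product is over the
component sizes `c` of `R`. -/
theorem disconnected_blowup_lower_bound (k n : ℕ) (hn : k ≤ n)
    (G : SimpleGraph (Fin k))
    (hcomp : ∀ c : G.ConnectedComponent, 2 ≤ compCard G c) :
    (k.factorial : ℝ) *
        (∏ c : G.ConnectedComponent,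
          (1 / ((k : ℝ) ^ (compCard G c) -
            (k : ℝ) * ((k : ℝ) / (compCard G c : ℝ)) ^ (compCard G c - 1)))) *
        (n.choose k : ℝ) ≤
      (maxCopyCount k n (rainbowOf G) : ℝ) := by
  rcases Nat.eq_zero_or_pos k with rfl | hk
  · have hempty : IsEmpty G.ConnectedComponent := ⟨fun C => C.ind fun v => v.elim0⟩
    have hone : copyCount 0 n (rainbowOf G) (fun _ _ => ∅) = 1 := by
      simp [copyCount, Function.injective_of_subsingleton]
    have hle := copyCount_le_maxCopyCount (n := n) (rainbowOf G) (χ := fun _ _ => ∅)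
      fun _ _ => rfl
    rw [hone] at hle
    simpa only [Nat.factorial_zero, Nat.cast_one, univ_eq_empty, prod_empty, Nat.choose_zero_right,
      mul_one, Nat.one_le_cast] using hle
  · have : NeZero k := ⟨hk.ne'⟩
    have hlim := (tendsto_finsetProd univ fun (C : G.ConnectedComponent) _ =>
      tendsto_unifProb_isCopyOn C (hcomp C)).const_mul (n.descFactorial k : ℝ)
    have hbound := le_of_tendsto' hlim fun D => by
      rw [← unifProb_isCanonicalCopy]
      exact descFactorial_mul_unifProb_le hcomp
    rw [mul_right_comm]
    rwa [Nat.descFactorial_eq_factorial_mul_choose, Nat.cast_mul] at hbound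
end
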